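/- arXiv:0708.1481 — 2 statements merged into one kernel-verified Lean document; each statement's English description precedes it below -/
import Mathlib

section
/- Let K be a field, S = K[x_1,...,x_n], I ⊂ S a monomial ideal, and u ∈ S a monomial which is regular on S/I (i.e., multiplication by u on S/I is injective). Then sdepth(S/(I,u)) = sdepth(S/I) − 1. -/
/-!
STATEMENT 0 (Theorem 1.1, first part): Let `K` be a field, `S = K[x_1,…,x_n]`,
`I ⊂ S` a monomial ideal, and `u ∈ S` a monomial which is regular on `S/I`
(i.e. multiplication by `u` on `S/I` is injective).  Then
`sdepth(S/(I,u)) = sdepth(S/I) − 1`, stated as `sdepth(S/(I,u)) + 1 = sdepth(S/I)`.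
-/

open MvPolynomial

noncomputable section

variable (K : Type*) [Field K] {n : ℕ}

/-- A monomial ideal: an ideal generated by monomials. -/
def IsMonomialIdeal (I : Ideal (MvPolynomial (Fin n) K)) : Prop :=
  ∃ A : Set (Fin n →₀ ℕ),
    I = Ideal.span ((fun d => (monomial d (1 : K) : MvPolynomial (Fin n) K)) '' A)

/-- The Stanley space `u·K[Z]`: the `K`-subspace of `K[x_1,…,x_n]` spanned by all
monomials `u·v` where `v` is a monomial in the variables of `Z`. -/
def stanleySpace (u : Fin n →₀ ℕ) (Z : Finset (Fin n)) : Submodule K (MvPolynomial (Fin n) K) :=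
  Submodule.span K
    ((fun e => (monomial (u + e) (1 : K) : MvPolynomial (Fin n) K)) ''
      {e : Fin n →₀ ℕ | ∀ i ∉ Z, e i = 0})

/-- `I^c`: the `K`-subspace of `S` spanned by all monomials not belonging to `I`. -/
def monomialComplement (I : Ideal (MvPolynomial (Fin n) K)) :
    Submodule K (MvPolynomial (Fin n) K) :=
  Submodule.span K
    {f : MvPolynomial (Fin n) K | ∃ d : Fin n →₀ ℕ, f = monomial d (1 : K) ∧ f ∉ I}

/-- A Stanley decomposition of `S/I`: a presentation of `I^c` as a finite direct
sum of Stanley spaces. -/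
structure StanleyDecomposition (I : Ideal (MvPolynomial (Fin n) K)) where
  r : ℕ
  u : Fin r → (Fin n →₀ ℕ)
  Z : Fin r → Finset (Fin n)
  indep : iSupIndep fun i => stanleySpace K (u i) (Z i)
  sup_eq : ⨆ i, stanleySpace K (u i) (Z i) = monomialComplement K I

/-- The Stanley depth of `S/I`: the maximum, over all Stanley decompositions `D` of `S/I`,
of the minimal dimension `|Z_i|` of a Stanley space occurring in `D`. -/
def sdepth (I : Ideal (MvPolynomial (Fin n) K)) : ℕ :=
  sSup {d : ℕ | ∃ D : StanleyDecomposition K I, ∀ i, d ≤ (D.Z i).card}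

/-- The exponents of the monomials in the Stanley space `x^v · K[Z]`. -/
def stanleyBox {σ : Type*} (v : σ →₀ ℕ) (Z : Finset σ) : Set (σ →₀ ℕ) :=
  {x | ∀ i, v i ≤ x i ∧ (i ∉ Z → x i = v i)}

/-- `Q` is a finite disjoint union of boxes `stanleyBox v Z` with `d ≤ #Z`. -/
def HasBoxPartition {σ : Type*} (d : ℕ) (Q : Set (σ →₀ ℕ)) : Prop :=
  ∃ F : Finset ((σ →₀ ℕ) × Finset σ),
    (F : Set ((σ →₀ ℕ) × Finset σ)).PairwiseDisjoint (fun p => stanleyBox p.1 p.2) ∧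
      ⋃ p ∈ F, stanleyBox p.1 p.2 = Q ∧ ∀ p ∈ F, d ≤ p.2.card

section Combinatorics

variable {σ : Type*} {d : ℕ}

namespace HasBoxPartition

lemma empty : HasBoxPartition d (∅ : Set (σ →₀ ℕ)) := ⟨∅, by simp, by simp, by simp⟩

lemma box {v : σ →₀ ℕ} {Z : Finset σ} (h : d ≤ Z.card) : HasBoxPartition d (stanleyBox v Z) :=
  ⟨{(v, Z)}, by simp, by simp, by simpa using h⟩

lemma union {Q R : Set (σ →₀ ℕ)} (hQ : HasBoxPartition d Q) (hR : HasBoxPartition d R)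
    (hQR : Disjoint Q R) : HasBoxPartition d (Q ∪ R) := by
  classical
  obtain ⟨F, hF, rfl, hFd⟩ := hQ
  obtain ⟨G, hG, rfl, hGd⟩ := hR
  refine ⟨F ∪ G, ?_, Finset.set_biUnion_union _ _ _, ?_⟩
  · rw [Finset.coe_union, Set.pairwiseDisjoint_union]
    exact ⟨hF, hG, fun p hp q hq _ => hQR.mono
      (Set.subset_biUnion_of_mem (u := fun p => stanleyBox p.1 p.2) (Finset.mem_coe.1 hp))
      (Set.subset_biUnion_of_mem (u := fun p => stanleyBox p.1 p.2) (Finset.mem_coe.1 hq))⟩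
  · intro p hp
    exact (Finset.mem_union.1 hp).elim (hFd p) (hGd p)

lemma biUnion {ι : Type*} (s : Finset ι) (Q : ι → Set (σ →₀ ℕ))
    (hQ : ∀ i ∈ s, HasBoxPartition d (Q i)) (hs : (s : Set ι).PairwiseDisjoint Q) :
    HasBoxPartition d (⋃ i ∈ s, Q i) := by
  classical
  induction s using Finset.induction_on with
  | empty => simpa using empty
  | insert a s ha ih =>
    rw [Finset.set_biUnion_insert]
    rw [Finset.coe_insert, Set.pairwiseDisjoint_insert] at hs
    refine union (hQ a (by simp)) (ih (fun i hi => hQ i (by simp [hi])) hs.1) ?_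
    simp only [Set.disjoint_iUnion_right]
    exact fun i hi => hs.2 i hi (by rintro rfl; exact ha hi)

lemma box_inter_eq {v : σ →₀ ℕ} {Z : Finset σ} (h : d ≤ Z.card) (i : σ) (c : ℕ) :
    HasBoxPartition (d - 1) (stanleyBox v Z ∩ {x | x i = c}) := by
  classical
  by_cases hc : c = v i ∨ (i ∈ Z ∧ v i ≤ c)
  · have : stanleyBox v Z ∩ {x | x i = c} = stanleyBox (v.update i c) (Z.erase i) := by
      ext x
      simp only [stanleyBox, Set.mem_inter_iff, Set.mem_ofPred_eq, Finsupp.update_apply,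
        Finset.mem_erase]
      constructor
      · rintro ⟨hx, hi⟩ j
        have := hx j
        grind
      · intro hx
        have hi := hx i
        refine ⟨fun j => ?_, by grind⟩
        have := hx j
        grind
    rw [this]
    exact box ((Nat.sub_le_sub_right h 1).trans Finset.pred_card_le_card_erase)
  · have : stanleyBox v Z ∩ {x | x i = c} = ∅ := by
      refine Set.eq_empty_of_forall_notMem fun x hx => hc ?_
      have h1 := hx.1 i
      have h2 : x i = c := hx.2
      grind
    exact this ▸ empty

lemma box_diff_setOf_forall_le (g : σ →₀ ℕ) (s : Finset σ) {v : σ →₀ ℕ} {Z : Finset σ}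
    (h : d ≤ Z.card) :
    HasBoxPartition (d - 1) (stanleyBox v Z \ {x | ∀ i ∈ s, g i ≤ x i}) := by
  classical
  induction s using Finset.induction_on generalizing v with
  | empty => simpa using empty
  | insert a s ha ih =>
    have hsplit : stanleyBox v Z \ {x | ∀ i ∈ insert a s, g i ≤ x i} =
        (⋃ c ∈ Finset.range (g a), stanleyBox v Z ∩ {x | x a = c}) ∪
          (stanleyBox v Z ∩ {x | g a ≤ x a}) \ {x | ∀ i ∈ s, g i ≤ x i} := by
      ext x
      simp only [Set.mem_sdiff, Set.mem_ofPred_eq, Finset.forall_mem_insert, Set.mem_union,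
        Set.mem_iUnion, Finset.mem_range, Set.mem_inter_iff, exists_prop]
      have := lt_or_ge (x a) (g a)
      grind
    rw [hsplit]
    refine union (biUnion _ _ (fun c _ => box_inter_eq h a c) ?_) ?_ ?_
    · intro c _ c' _ hcc'
      exact Set.disjoint_left.2 fun x hx hx' => hcc' (hx.2.symm.trans hx'.2)
    · by_cases hc : a ∈ Z ∨ g a ≤ v a
      · have : stanleyBox v Z ∩ {x | g a ≤ x a} =
            stanleyBox (v.update a (max (v a) (g a))) Z := by
          ext x
          simp only [stanleyBox, Set.mem_inter_iff, Set.mem_ofPred_eq, Finsupp.update_apply]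
          constructor
          · rintro ⟨hx, hi⟩ j
            have := hx j
            grind
          · intro hx
            have hi := hx a
            refine ⟨fun j => ?_, by grind⟩
            have := hx j
            grind
        exact this ▸ ih
      · have : stanleyBox v Z ∩ {x | g a ≤ x a} = ∅ := by
          refine Set.eq_empty_of_forall_notMem fun x hx => hc ?_
          have h1 := hx.1 a
          have h2 : g a ≤ x a := hx.2
          grind
        rw [this, Set.empty_sdiff]
        exact empty
    · simp only [Set.disjoint_iUnion_left, Finset.mem_range]
      refine fun c hc => Set.disjoint_left.2 fun x hx hx' => ?_
      have h1 : x a = c := hx.2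
      have h2 : g a ≤ x a := hx'.1.2
      omega

lemma diff_Ici [Finite σ] {Q : Set (σ →₀ ℕ)} (hQ : HasBoxPartition d Q) (g : σ →₀ ℕ) :
    HasBoxPartition (d - 1) (Q \ Set.Ici g) := by
  classical
  have := Fintype.ofFinite σ
  obtain ⟨F, hF, rfl, hFd⟩ := hQ
  have hg : Set.Ici g = {x | ∀ i ∈ Finset.univ, g i ≤ x i} := by
    ext x
    simp [Finsupp.le_def]
  simp only [Set.iUnion_sdiff]
  refine biUnion F _ (fun p hp => ?_) (hF.mono_on fun p _ => Set.sdiff_subset)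
  rw [hg]
  exact box_diff_setOf_forall_le g _ (hFd p hp)

/-- The complement of a finitely generated upper set is a finite disjoint union of boxes. -/
lemma setOf_forall_not_le [Finite σ] (B : Finset (σ →₀ ℕ)) :
    HasBoxPartition 0 {x : σ →₀ ℕ | ∀ b ∈ B, ¬ b ≤ x} := by
  classical
  have := Fintype.ofFinite σ
  induction B using Finset.induction_on with
  | empty =>
    have : {x : σ →₀ ℕ | ∀ b ∈ (∅ : Finset (σ →₀ ℕ)), ¬ b ≤ x} = stanleyBox 0 Finset.univ := by
      ext x
      simp [stanleyBox]
    exact this ▸ box (Nat.zero_le _)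
  | insert a s ha ih =>
    have : {x : σ →₀ ℕ | ∀ b ∈ insert a s, ¬ b ≤ x} = {x | ∀ b ∈ s, ¬ b ≤ x} \ Set.Ici a := by
      ext x
      simp [and_comm]
    exact this ▸ ih.diff_Ici a

/-- If `P` does not depend on the coordinates in the support of `u ≠ 0`, then a partition of
`P \ Set.Ici u` extends to one of `P`, by making the coordinates in the support of `u` free in
all boxes that contain a point at which these coordinates vanish. -/
lemma of_diff_Ici {P : Set (σ →₀ ℕ)} {u : σ →₀ ℕ} (hu : u ≠ 0)
    (hP : ∀ x ∈ P, ∀ y : σ →₀ ℕ, (∀ i ∉ u.support, y i = x i) → y ∈ P)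
    (h : HasBoxPartition d (P \ Set.Ici u)) : HasBoxPartition (d + 1) P := by
  classical
  obtain ⟨F, hF, hFP, hFd⟩ := h
  have hsub : ∀ p ∈ F, stanleyBox p.1 p.2 ⊆ P \ Set.Ici u := fun p hp =>
    hFP ▸ Set.subset_biUnion_of_mem (u := fun p => stanleyBox p.1 p.2) (Finset.mem_coe.2 hp)
  obtain ⟨j, hj⟩ := Finsupp.support_nonempty_iff.2 hu
  let z : (σ →₀ ℕ) → (σ →₀ ℕ) := fun x => x.filter (· ∉ u.support)
  have hz : ∀ x i, z x i = if i ∈ u.support then 0 else x i := fun x i => by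
    by_cases hi : i ∈ u.support <;> simp_all [z]
  have hzmem : ∀ (x v : σ →₀ ℕ) (Z : Finset σ), (∀ i ∈ u.support, v i = 0) →
      (x ∈ stanleyBox v (Z ∪ u.support) ↔ z x ∈ stanleyBox v Z) := by
    intro x v Z hv
    refine forall_congr' fun i => ?_
    have := hv i
    rw [hz, Finset.mem_union]
    grind
  refine ⟨(F.filter fun p => ∀ i ∈ u.support, p.1 i = 0).image
    fun p => (p.1, p.2 ∪ u.support), ?_, ?_, ?_⟩
  · intro p' hp' q' hq' hpq
    simp only [Finset.coe_image, Set.mem_image, Finset.mem_coe, Finset.mem_filter] at hp' hq'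
    obtain ⟨p, ⟨hp, hp0⟩, rfl⟩ := hp'
    obtain ⟨q, ⟨hq, hq0⟩, rfl⟩ := hq'
    refine Set.disjoint_left.2 fun x hx hx' => ?_
    exact Set.disjoint_left.1 (hF hp hq (by rintro rfl; exact hpq rfl))
      ((hzmem x _ _ hp0).1 hx) ((hzmem x _ _ hq0).1 hx')
  · ext x
    simp only [Finset.mem_image, Finset.mem_filter, Set.mem_iUnion, exists_prop]
    constructor
    · rintro ⟨_, ⟨p, ⟨hp, hp0⟩, rfl⟩, hx⟩
      refine hP _ (hsub p hp ((hzmem x _ _ hp0).1 hx)).1 x fun i hi => ?_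
      rw [hz, if_neg hi]
    · intro hx
      have hzx : z x ∈ P \ Set.Ici u := by
        refine ⟨hP x hx _ fun i hi => by rw [hz, if_neg hi], fun hle => ?_⟩
        have := (Finsupp.le_def.1 hle) j
        rw [hz, if_pos hj] at this
        exact Finsupp.mem_support_iff.1 hj (Nat.le_zero.1 this)
      rw [← hFP] at hzx
      simp only [Set.mem_iUnion, exists_prop] at hzx
      obtain ⟨p, hp, hxp⟩ := hzx
      have hp0 : ∀ i ∈ u.support, p.1 i = 0 := fun i hi => by
        have := (hxp i).1
        rwa [hz, if_pos hi, Nat.le_zero] at this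
      exact ⟨_, ⟨p, ⟨hp, hp0⟩, rfl⟩, (hzmem x _ _ hp0).2 hxp⟩
  · simp only [Finset.mem_image, Finset.mem_filter]
    rintro _ ⟨p, ⟨hp, hp0⟩, rfl⟩
    refine Nat.succ_le_of_lt ((hFd p hp).trans_lt (Finset.card_lt_card ?_))
    refine Finset.ssubset_iff_subset_ne.2 ⟨Finset.subset_union_left, fun heq => ?_⟩
    have hle : p.1 + u ∈ stanleyBox p.1 p.2 := by
      intro i
      refine ⟨by simp, fun hi => ?_⟩
      have : i ∉ u.support := fun h => hi (heq ▸ Finset.mem_union_right _ h)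
      simpa using this
    exact (hsub p hp hle).2 (by simp)

end HasBoxPartition

end Combinatorics

section MonomialIdeals

variable {K}

lemma stanleySpace_eq_restrictSupport (v : Fin n →₀ ℕ) (Z : Finset (Fin n)) :
    stanleySpace K v Z = restrictSupport K (stanleyBox v Z) := by
  rw [restrictSupport_eq_span, stanleySpace]
  congr 1
  ext f
  constructor
  · rintro ⟨e, he, rfl⟩
    exact ⟨v + e, fun i => ⟨by simp, fun hi => by simp [he i hi]⟩, rfl⟩
  · rintro ⟨x, hx, rfl⟩
    have hvx : v ≤ x := fun i => (hx i).1
    exact ⟨x - v, fun i hi => by simp [(hx i).2 hi], by simp [add_tsub_cancel_of_le hvx]⟩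

lemma monomialComplement_eq_restrictSupport (I : Ideal (MvPolynomial (Fin n) K)) :
    monomialComplement K I = restrictSupport K {x | monomial x (1 : K) ∉ I} := by
  rw [restrictSupport_eq_span, monomialComplement]
  congr 1
  ext f
  constructor
  · rintro ⟨x, rfl, hx⟩
    exact ⟨x, hx, rfl⟩
  · rintro ⟨x, hx, rfl⟩
    exact ⟨x, rfl, hx⟩

lemma restrictSupport_iUnion {σ : Type*} {ι : Sort*} (Q : ι → Set (σ →₀ ℕ)) :
    restrictSupport K (⋃ i, Q i) = ⨆ i, restrictSupport K (Q i) := by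
  simp only [restrictSupport_eq_span, Set.image_iUnion, Submodule.span_iUnion]

lemma restrictSupport_le_iff {σ : Type*} {Q R : Set (σ →₀ ℕ)} :
    restrictSupport K Q ≤ restrictSupport K R ↔ Q ⊆ R := by
  refine ⟨fun h x hx => ?_, restrictSupport_mono (R := K)⟩
  have := h ((monomial_mem_restrictSupport K (r := 1)).2 (Or.inl hx))
  simpa using (monomial_mem_restrictSupport K).1 this

lemma restrictSupport_inj {σ : Type*} {Q R : Set (σ →₀ ℕ)} :
    restrictSupport K Q = restrictSupport K R ↔ Q = R := by
  simp only [le_antisymm_iff, restrictSupport_le_iff]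

lemma disjoint_restrictSupport_iff {σ : Type*} {Q R : Set (σ →₀ ℕ)} :
    Disjoint (restrictSupport K Q) (restrictSupport K R) ↔ Disjoint Q R := by
  rw [Submodule.disjoint_def, Set.disjoint_left]
  refine ⟨fun h x hx hx' => ?_, fun h f hf hf' => ?_⟩
  · simpa using h (monomial x 1) ((monomial_mem_restrictSupport K).2 (Or.inl hx))
      ((monomial_mem_restrictSupport K).2 (Or.inl hx'))
  · rw [mem_restrictSupport_iff] at hf hf'
    refine MvPolynomial.support_eq_empty.1 (Finset.eq_empty_of_forall_notMem fun x hx => ?_)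
    exact h (hf hx) (hf' hx)

lemma iSupIndep_restrictSupport_iff {σ ι : Type*} {Q : ι → Set (σ →₀ ℕ)} :
    (iSupIndep fun i => restrictSupport K (Q i)) ↔ Pairwise (Function.onFun Disjoint Q) := by
  simp only [iSupIndep_def, ← restrictSupport_iUnion, disjoint_restrictSupport_iff,
    Set.disjoint_iUnion_right]
  exact ⟨fun h i j hij => h i j hij.symm, fun h i j hij => h hij.symm⟩

lemma exists_stanleyDecomposition_iff (I : Ideal (MvPolynomial (Fin n) K)) (d : ℕ) :
    (∃ D : StanleyDecomposition K I, ∀ i, d ≤ (D.Z i).card) ↔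
      HasBoxPartition d {x | monomial x (1 : K) ∉ I} := by
  constructor
  · rintro ⟨⟨r, v, Z, hind, hsup⟩, hd⟩
    simp only [stanleySpace_eq_restrictSupport, iSupIndep_restrictSupport_iff] at hind
    simp only [stanleySpace_eq_restrictSupport, monomialComplement_eq_restrictSupport,
      ← restrictSupport_iUnion, restrictSupport_inj] at hsup
    classical
    refine ⟨Finset.univ.image fun i => (v i, Z i), ?_, ?_, ?_⟩
    · intro p hp q hq hpq
      simp only [Finset.coe_image, Finset.coe_univ, Set.image_univ, Set.mem_range] at hp hq
      obtain ⟨i, rfl⟩ := hp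
      obtain ⟨j, rfl⟩ := hq
      exact hind (by rintro rfl; exact hpq rfl)
    · rw [← hsup]
      simp
    · simpa using hd
  · rintro ⟨F, hF, hFQ, hFd⟩
    let e := F.equivFin.symm
    refine ⟨⟨F.card, fun i => (e i).1.1, fun i => (e i).1.2, ?_, ?_⟩, fun i => hFd _ (e i).2⟩
    · simp only [stanleySpace_eq_restrictSupport, iSupIndep_restrictSupport_iff]
      exact fun i j hij =>
        hF (e i).2 (e j).2 fun h => hij (e.injective (Subtype.ext h))
    · simp only [stanleySpace_eq_restrictSupport, monomialComplement_eq_restrictSupport,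
        ← restrictSupport_iUnion, restrictSupport_inj]
      rw [← hFQ]
      refine Eq.trans ?_ (Set.biUnion_eq_iUnion (F : Set ((Fin n →₀ ℕ) × Finset (Fin n)))
        fun p _ => stanleyBox p.1 p.2).symm
      exact e.surjective.iUnion_comp fun p : F => stanleyBox p.1.1 p.1.2

lemma sdepth_eq_sSup (I : Ideal (MvPolynomial (Fin n) K)) :
    sdepth K I = sSup {d | HasBoxPartition d {x | monomial x (1 : K) ∉ I}} := by
  simp only [sdepth, exists_stanleyDecomposition_iff]

lemma bddAbove_hasBoxPartition {σ : Type*} [Fintype σ] {Q : Set (σ →₀ ℕ)} (hQ : Q.Nonempty) :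
    BddAbove {d | HasBoxPartition d Q} := by
  refine ⟨Fintype.card σ, ?_⟩
  rintro d ⟨F, -, rfl, hFd⟩
  obtain ⟨x, hx⟩ := hQ
  simp only [Set.mem_iUnion, exists_prop] at hx
  obtain ⟨p, hp, -⟩ := hx
  exact (hFd p hp).trans (Finset.card_le_univ _)

lemma monomial_mem_span_monomial_iff {σ : Type*} {A : Set (σ →₀ ℕ)} {x : σ →₀ ℕ} :
    monomial x (1 : K) ∈ Ideal.span ((fun a => monomial a (1 : K)) '' A) ↔ ∃ a ∈ A, a ≤ x := by
  classical
  rw [mem_ideal_span_monomial_image]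
  simp [support_monomial]

lemma IsMonomialIdeal.hasBoxPartition_zero {I : Ideal (MvPolynomial (Fin n) K)}
    (hI : IsMonomialIdeal K I) : HasBoxPartition 0 {x | monomial x (1 : K) ∉ I} := by
  classical
  obtain ⟨A, rfl⟩ := hI
  obtain ⟨s, hsA, hs⟩ := (Submodule.fg_span_iff_fg_span_finset_subset
    (R := MvPolynomial (Fin n) K) ((fun a => monomial a (1 : K)) '' A)).1 (IsNoetherian.noetherian _)
  obtain ⟨B, -, rfl⟩ := Finset.subset_set_image_iff.1 hsA
  convert HasBoxPartition.setOf_forall_not_le B using 1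
  ext x
  change monomial x 1 ∉ Submodule.span _ _ ↔ _
  rw [hs, Finset.coe_image]
  simpa using (monomial_mem_span_monomial_iff (K := K) (A := (B : Set (Fin n →₀ ℕ))) (x := x)).not

/-- If the monomial `x^u` is regular modulo `I`, then membership of monomials in `I` does not
depend on the exponents of the variables dividing `x^u`. -/
lemma monomial_notMem_of_regular {I : Ideal (MvPolynomial (Fin n) K)} {u : Fin n →₀ ℕ}
    (hreg : Function.Injective fun f : MvPolynomial (Fin n) K ⧸ I =>
      (monomial u (1 : K) : MvPolynomial (Fin n) K) • f)
    {x y : Fin n →₀ ℕ} (hx : monomial x (1 : K) ∉ I) (hxy : ∀ i ∉ u.support, y i = x i) :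
    monomial y (1 : K) ∉ I := by
  have hcancel : ∀ f, monomial u (1 : K) * f ∈ I → f ∈ I := by
    intro f hf
    rw [← Ideal.Quotient.eq_zero_iff_mem] at hf ⊢
    refine hreg ?_
    exact hf.trans (smul_zero _).symm
  have hpow : ∀ k : ℕ, monomial (k • u + x) (1 : K) ∉ I := by
    intro k
    induction k with
    | zero => simpa using hx
    | succ k ih =>
      refine fun h => ih (hcancel _ ?_)
      rw [monomial_mul, one_mul, ← add_assoc, ← succ_nsmul']
      exact h
  have hle : y ≤ y.degree • u + x := by
    intro i
    by_cases hi : i ∈ u.support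
    · have h1 : 1 ≤ u i := Nat.one_le_iff_ne_zero.2 (Finsupp.mem_support_iff.1 hi)
      have h2 : y i ≤ y.degree := Finsupp.le_degree i y
      have h3 := Nat.mul_le_mul h2 h1
      simp only [Finsupp.add_apply, Finsupp.smul_apply, smul_eq_mul]
      omega
    · simp [hxy i hi]
  refine fun hy => hpow y.degree ?_
  rw [← tsub_add_cancel_of_le hle, ← one_mul (1 : K), ← monomial_mul]
  exact I.mul_mem_left _ hy

end MonomialIdeals

theorem sdepth_sup_regular_monomial {K : Type*} [Field K] {n : ℕ}
    (I : Ideal (MvPolynomial (Fin n) K)) (hI : IsMonomialIdeal K I) (hIproper : I ≠ ⊤)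
    (u : Fin n →₀ ℕ) (hu : u ≠ 0)
    (hreg : Function.Injective fun f : MvPolynomial (Fin n) K ⧸ I =>
      (monomial u (1 : K) : MvPolynomial (Fin n) K) • f) :
    sdepth K (I ⊔ Ideal.span {(monomial u (1 : K) : MvPolynomial (Fin n) K)}) + 1
      = sdepth K I := by
  set P : Set (Fin n →₀ ℕ) := {x | monomial x (1 : K) ∉ I} with hPdef
  have hJ : {x | monomial x (1 : K) ∉ I ⊔ Ideal.span {monomial u (1 : K)}} = P \ Set.Ici u := by
    obtain ⟨A, rfl⟩ := hI
    have himage : (fun a => monomial a (1 : K)) '' A ∪ {monomial u (1 : K)} =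
        (fun a => monomial a (1 : K)) '' (A ∪ {u}) := by
      rw [Set.image_union, Set.image_singleton]
    ext x
    rw [← Ideal.span_union, himage]
    simp only [hPdef, Set.mem_ofPred_eq, Set.mem_sdiff, monomial_mem_span_monomial_iff,
      Set.mem_Ici, Set.mem_union, Set.mem_singleton_iff]
    grind
  have h0 : (0 : Fin n →₀ ℕ) ∈ P := fun h => hIproper ((Ideal.eq_top_iff_one I).2 h)
  have h0J : (0 : Fin n →₀ ℕ) ∈ P \ Set.Ici u := ⟨h0, fun h => hu (nonpos_iff_eq_zero.1 h)⟩
  have hup : ∀ d, HasBoxPartition d (P \ Set.Ici u) → HasBoxPartition (d + 1) P := fun d =>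
    HasBoxPartition.of_diff_Ici hu fun _ hx _ hxy => monomial_notMem_of_regular hreg hx hxy
  have hPne : {d | HasBoxPartition d P}.Nonempty := ⟨0, hI.hasBoxPartition_zero⟩
  have hJne : {d | HasBoxPartition d (P \ Set.Ici u)}.Nonempty :=
    ⟨0, hI.hasBoxPartition_zero.diff_Ici u⟩
  have hPbdd := bddAbove_hasBoxPartition ⟨0, h0⟩
  have hJbdd := bddAbove_hasBoxPartition ⟨0, h0J⟩
  rw [sdepth_eq_sSup, sdepth_eq_sSup, hJ]
  have h1 := le_csSup hPbdd (hup _ (Nat.sSup_mem hJne hJbdd))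
  have h2 := le_csSup hJbdd ((Nat.sSup_mem hPne hPbdd).diff_Ici u)
  rw [← hPdef]
  omega

end
end

section
/- Let K be a field, S = K[x_1,...,x_n], and let u_1,...,u_k be a regular sequence of monomials in S. Then S/(u_1,...,u_k) is pretty clean. -/
/-!
STATEMENT 6 (Corollary 2.2): Let `K` be a field, `S = K[x_1,…,x_n]`, and let
`u_1,…,u_k` be a regular sequence of monomials in `S`.  Then `S/(u_1,…,u_k)` is
pretty clean.
-/

open MvPolynomial

noncomputable section

/-- A prime filtration of `R/I`: a chain of ideals `I = I_0 ⊆ I_1 ⊆ … ⊆ I_r = R`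
together with prime ideals `P_1,…,P_r` such that `I_j/I_{j−1} ≅ R/P_j` as `R`-modules. -/
structure PrimeFiltration {R : Type*} [CommRing R] (I : Ideal R) where
  r : ℕ
  ideals : Fin (r + 1) → Ideal R
  first : ideals 0 = I
  last : ideals (Fin.last r) = ⊤
  le_succ : ∀ j : Fin r, ideals j.castSucc ≤ ideals j.succ
  primes : Fin r → Ideal R
  primes_isPrime : ∀ j : Fin r, (primes j).IsPrime
  iso : ∀ j : Fin r,
    Nonempty ((↥(ideals j.succ) ⧸
        (Submodule.comap (ideals j.succ).subtype (ideals j.castSucc))) ≃ₗ[R] (R ⧸ primes j))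

/-- A prime filtration is pretty clean if, whenever `i < j` and `P_i ⊆ P_j`,
one has `P_i = P_j`. -/
def PrimeFiltration.IsPrettyClean {R : Type*} [CommRing R] {I : Ideal R}
    (F : PrimeFiltration I) : Prop :=
  ∀ i j : Fin F.r, i < j → F.primes i ≤ F.primes j → F.primes i = F.primes j

/-- `R/I` is pretty clean if it admits a pretty clean prime filtration. -/
def Ideal.IsPrettyClean {R : Type*} [CommRing R] (I : Ideal R) : Prop :=
  ∃ F : PrimeFiltration I, F.IsPrettyClean

section PrimeChain

variable {R : Type*} [CommRing R]

/-- `PrimeChain Ps I J` says that `J` is reached from `I` by successively adjoining elements `f`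
for which the colon ideal by `f` is a prime ideal belonging to `Ps`. -/
inductive PrimeChain (Ps : Set (Ideal R)) : Ideal R → Ideal R → Prop
  | refl (I : Ideal R) : PrimeChain Ps I I
  | step (I J P : Ideal R) (f : R) (hmem : P ∈ Ps) (hprime : P.IsPrime)
      (hcolon : ∀ g, g * f ∈ I ↔ g ∈ P) (hchain : PrimeChain Ps (I ⊔ Ideal.span {f}) J) :
      PrimeChain Ps I J

namespace PrimeChain

variable {Ps : Set (Ideal R)}

theorem trans {I J L : Ideal R} (h : PrimeChain Ps I J) (h' : PrimeChain Ps J L) :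
    PrimeChain Ps I L := by
  induction h with
  | refl => exact h'
  | step I J P f hmem hprime hcolon _ ih => exact step I L P f hmem hprime hcolon (ih h')

/-- Multiplication by `v` turns a chain starting at the colon ideal `I : v` into a chain
starting at `I`. -/
theorem mul_left {A B I : Ideal R} {v : R} (h : PrimeChain Ps A B)
    (hA : ∀ g, g * v ∈ I ↔ g ∈ A) : PrimeChain Ps I (I ⊔ Ideal.span {v} * B) := by
  induction h generalizing I with
  | refl A =>
    have : I ⊔ Ideal.span {v} * A = I := by
      rw [sup_eq_left, Ideal.span_singleton_mul_le_iff]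
      intro z hz
      rw [mul_comm]
      exact (hA z).2 hz
    rw [this]
    exact refl I
  | step A B P f hmem hprime hcolon hchain ih =>
    have hAB : ∀ {A B : Ideal R}, PrimeChain Ps A B → A ≤ B := by
      intro A B h
      induction h with
      | refl => exact le_rfl
      | step _ _ _ _ _ _ _ _ ih => exact le_sup_left.trans ih
    have hfB : f ∈ B := hAB hchain (Ideal.mem_sup_right (Ideal.mem_span_singleton_self f))
    refine step I _ P (f * v) hmem hprime (fun g => ?_) ?_
    · rw [← mul_assoc, hA, hcolon]
    · have key := ih (I := I ⊔ Ideal.span {f * v}) (fun g => ?_)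
      · convert key using 1
        rw [sup_assoc]
        congr 1
        refine (sup_eq_right.2 ?_).symm
        rw [Ideal.span_singleton_le_iff_mem, mul_comm f v]
        exact Ideal.mul_mem_mul (Ideal.mem_span_singleton_self v) hfB
      · simp only [sup_comm _ (Ideal.span {_}), Ideal.mem_span_singleton_sup]
        constructor
        · rintro ⟨a, b, hb, hab⟩
          refine ⟨a, g - a * f, (hA _).1 ?_, by ring⟩
          convert hb using 1
          linear_combination -hab
        · rintro ⟨a, b, hb, rfl⟩
          exact ⟨a, b * v, (hA _).2 hb, by ring⟩

end PrimeChain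

/-- If `P` is the colon ideal of `I` by `f`, then `(I + (f)) / I` is isomorphic to `R / P`. -/
theorem nonempty_quotient_equiv_of_colon {I P : Ideal R} {f : R}
    (hcolon : ∀ g, g * f ∈ I ↔ g ∈ P) :
    Nonempty ((↥(I ⊔ Ideal.span {f}) ⧸
      Submodule.comap (I ⊔ Ideal.span {f}).subtype I) ≃ₗ[R] (R ⧸ P)) := by
  have hf : f ∈ I ⊔ Ideal.span {f} := Ideal.mem_sup_right (Ideal.mem_span_singleton_self f)
  let φ : R →ₗ[R] ↥(I ⊔ Ideal.span {f}) ⧸ Submodule.comap (I ⊔ Ideal.span {f}).subtype I :=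
    (Submodule.mkQ _).comp (LinearMap.toSpanSingleton R _ ⟨f, hf⟩)
  have hker : LinearMap.ker φ = P := by
    ext g
    rw [LinearMap.mem_ker, ← hcolon]
    simp [φ]
  have hsurj : Function.Surjective φ := by
    intro y
    obtain ⟨⟨y, hy⟩, rfl⟩ := Submodule.mkQ_surjective _ y
    have hy' := hy
    rw [sup_comm, Ideal.mem_span_singleton_sup] at hy'
    obtain ⟨a, b, hb, rfl⟩ := hy'
    refine ⟨a, ?_⟩
    refine (Submodule.Quotient.eq _).2 ?_
    simpa using hb
  exact ⟨((Submodule.quotEquivOfEq _ _ hker.symm).trans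
    (φ.quotKerEquivOfSurjective hsurj)).symm⟩

theorem PrimeChain.exists_primeFiltration {Ps : Set (Ideal R)} {I J : Ideal R}
    (h : PrimeChain Ps I J) (hJ : J = ⊤) :
    ∃ F : PrimeFiltration I, ∀ j, F.primes j ∈ Ps := by
  induction h with
  | refl I =>
    exact ⟨⟨0, fun _ => I, rfl, hJ, fun j => j.elim0, fun j => j.elim0, fun j => j.elim0,
      fun j => j.elim0⟩, fun j => j.elim0⟩
  | step I J P f hmem hprime hcolon _ ih =>
    obtain ⟨F, hF⟩ := ih hJ
    refine ⟨⟨F.r + 1, Fin.cons I F.ideals, rfl, F.last, ?_, Fin.cons P F.primes, ?_, ?_⟩, ?_⟩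
    · intro j
      cases j using Fin.cases with
      | zero =>
        change I ≤ F.ideals 0
        rw [F.first]
        exact le_sup_left
      | succ j => exact F.le_succ j
    · intro j
      cases j using Fin.cases with
      | zero => exact hprime
      | succ j => exact F.primes_isPrime j
    · intro j
      cases j using Fin.cases with
      | zero =>
        change Nonempty ((↥(F.ideals 0) ⧸
          (Submodule.comap (F.ideals 0).subtype I)) ≃ₗ[R] (R ⧸ P))
        rw [F.first]
        exact nonempty_quotient_equiv_of_colon hcolon
      | succ j => exact F.iso j
    · intro j
      cases j using Fin.cases with
      | zero => exact hmem
      | succ j => exact hF j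

end PrimeChain

namespace MvPolynomial

theorem isPrime_span_X_image {σ A : Type*} [CommRing A] [IsDomain A] (s : Set σ) :
    (Ideal.span (X '' s : Set (MvPolynomial σ A))).IsPrime := by
  classical
  let φ : MvPolynomial σ A →ₐ[A] MvPolynomial σ A := aeval fun i => if i ∈ s then 0 else X i
  suffices h : Ideal.span (X '' s : Set (MvPolynomial σ A)) = RingHom.ker φ by
    rw [h]
    exact RingHom.ker_isPrime _
  apply le_antisymm
  · rw [Ideal.span_le]
    rintro _ ⟨i, hi, rfl⟩
    simp [φ, hi]
  · have hsub : ∀ p, p - φ p ∈ Ideal.span (X '' s : Set (MvPolynomial σ A)) := by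
      intro p
      induction p using MvPolynomial.induction_on with
      | C a => simp [φ]
      | add p q hp hq =>
        rw [map_add, add_sub_add_comm]
        exact add_mem hp hq
      | mul_X p i hp =>
        by_cases hi : i ∈ s
        · have : p * X i - φ (p * X i) = p * X i := by simp [φ, hi]
          rw [this]
          exact Ideal.mul_mem_left _ _ (Ideal.subset_span ⟨i, hi, rfl⟩)
        · have : p * X i - φ (p * X i) = (p - φ p) * X i := by simp [φ, hi, sub_mul]
          rw [this]
          exact Ideal.mul_mem_right _ _ hp
    intro p hp
    simpa [(RingHom.mem_ker).1 hp] using hsub p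

theorem mem_span_range_monomial {σ ι A : Type*} [CommSemiring A] {u : ι → σ →₀ ℕ}
    {p : MvPolynomial σ A} :
    p ∈ Ideal.span (Set.range fun i => monomial (u i) (1 : A)) ↔
      ∀ m ∈ p.support, ∃ i, u i ≤ m := by
  have := mem_ideal_span_monomial_image (x := p) (s := Set.range u)
  rw [← Set.range_comp'] at this
  simpa using this

theorem mul_monomial_mem_span_range_monomial {σ ι A : Type*} [CommSemiring A]
    {u : ι → σ →₀ ℕ} {v : σ →₀ ℕ} {p : MvPolynomial σ A} :
    p * monomial v 1 ∈ Ideal.span (Set.range fun i => monomial (u i) (1 : A)) ↔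
      ∀ m ∈ p.support, ∃ i, u i ≤ m + v := by
  rw [mem_span_range_monomial]
  constructor
  · exact fun h m hm => h (m + v) (by simpa [coeff_mul_monomial] using hm)
  · intro h m hm
    rw [mem_support_iff, coeff_mul_monomial'] at hm
    split_ifs at hm with hvm
    · obtain ⟨i, hi⟩ := h (m - v) (by simpa using hm)
      exact ⟨i, by rwa [tsub_add_cancel_of_le hvm] at hi⟩
    · exact absurd rfl hm

theorem eq_of_span_X_image_le {σ A : Type*} [CommSemiring A] [Nontrivial A] {s t : Finset σ}
    (hcard : s.card = t.card)
    (h : Ideal.span (X '' (s : Set σ) : Set (MvPolynomial σ A)) ≤ Ideal.span (X '' (t : Set σ))) :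
    s = t := by
  classical
  refine Finset.eq_of_subset_of_card_le (fun i hi => ?_) hcard.ge
  have := mem_ideal_span_X_image.1 (h (Ideal.subset_span ⟨i, hi, rfl⟩)) (Finsupp.single i 1)
    (by simp [support_X])
  obtain ⟨j, hj, hij⟩ := this
  rw [Finsupp.single_apply_ne_zero] at hij
  exact hij.1 ▸ hj

/-- The ideals generated by exactly `k` of the variables. -/
def variableIdeals (σ A : Type*) [CommSemiring A] (k : ℕ) : Set (Ideal (MvPolynomial σ A)) :=
  {P | ∃ s : Finset σ, s.card = k ∧ P = Ideal.span (X '' (s : Set σ))}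

/-- If one of the monomials `u j` factors as a product of monomials `w` and `v`, with `v` coprime
to the other `u i`, then a chain for `u` is obtained from chains for the families in which `u j`
is replaced by `w` and by `v`. -/
theorem primeChain_of_split {σ ι A : Type*} [CommRing A] [DecidableEq ι]
    {Ps : Set (Ideal (MvPolynomial σ A))} {u : ι → σ →₀ ℕ} {j : ι} {v w : σ →₀ ℕ}
    (huj : u j = w + v) (hdisj : ∀ i, i ≠ j → Disjoint (u i) v)
    (hw : PrimeChain Ps
      (Ideal.span (Set.range fun i => monomial (Function.update u j w i) (1 : A))) ⊤)
    (hv : PrimeChain Ps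
      (Ideal.span (Set.range fun i => monomial (Function.update u j v i) (1 : A))) ⊤) :
    PrimeChain Ps (Ideal.span (Set.range fun i => monomial (u i) (1 : A))) ⊤ := by
  have hcolon : ∀ g, g * monomial v 1 ∈
      Ideal.span (Set.range fun i => monomial (u i) (1 : A)) ↔ g ∈
      Ideal.span (Set.range fun i => monomial (Function.update u j w i) (1 : A)) := by
    intro g
    rw [mul_monomial_mem_span_range_monomial, mem_span_range_monomial]
    refine forall₂_congr fun m _ => exists_congr fun i => ?_
    by_cases hi : i = j
    · subst hi
      simp [huj]
    · rw [Function.update_of_ne hi]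
      refine ⟨fun h a => ?_, fun h => h.trans le_self_add⟩
      have h1 := h a
      have h2 := DFunLike.congr_fun (disjoint_iff.1 (hdisj i hi)) a
      simp only [Finsupp.inf_apply, Finsupp.add_apply, bot_eq_zero, Finsupp.coe_zero,
        Pi.zero_apply] at h1 h2
      omega
  refine (hw.mul_left hcolon).trans ?_
  convert hv using 1
  rw [Ideal.mul_top]
  apply le_antisymm
  · refine sup_le (Ideal.span_le.2 ?_) (Ideal.span_le.2 ?_)
    · rintro _ ⟨i, rfl⟩
      refine mem_span_range_monomial.2 fun m hm => ⟨i, ?_⟩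
      obtain rfl := Finset.mem_singleton.1 (support_monomial_subset hm)
      by_cases hi : i = j
      · subst hi
        simp [huj]
      · simp [Function.update_of_ne hi]
    · rintro _ rfl
      exact Ideal.subset_span ⟨j, by simp⟩
  · refine Ideal.span_le.2 ?_
    rintro _ ⟨i, rfl⟩
    by_cases hi : i = j
    · subst hi
      exact Ideal.mem_sup_right (Ideal.subset_span (by simp))
    · exact Ideal.mem_sup_left (Ideal.subset_span ⟨i, by simp [Function.update_of_ne hi]⟩)

theorem primeChain_of_pairwise_disjoint {σ ι A : Type*} [CommRing A] [IsDomain A] [Fintype ι]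
    (u : ι → σ →₀ ℕ) (hdisj : Pairwise fun i j => Disjoint (u i) (u j)) :
    PrimeChain (variableIdeals σ A (Fintype.card ι))
      (Ideal.span (Set.range fun i => monomial (u i) (1 : A))) ⊤ := by
  classical
  induction hd : ∑ i, (u i).degree using Nat.strong_induction_on generalizing u with
  | _ d ih =>
  by_cases hzero : ∃ i, u i = 0
  · obtain ⟨i, hi⟩ := hzero
    have : Ideal.span (Set.range fun i => monomial (u i) (1 : A)) = ⊤ := by
      rw [Ideal.eq_top_iff_one]
      exact Ideal.subset_span ⟨i, by simp [hi]⟩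
    rw [this]
    exact .refl ⊤
  push Not at hzero
  have hsplit : ∀ j, ∃ a v, u j = Finsupp.single a 1 + v ∧ (u j).degree = 1 + v.degree := by
    intro j
    obtain ⟨a, ha⟩ := Finsupp.ne_iff.1 (hzero j)
    obtain ⟨v, hv⟩ := le_iff_exists_add.1
      (Finsupp.single_le_iff.2 (Nat.one_le_iff_ne_zero.2 ha))
    exact ⟨a, v, hv, by rw [hv, map_add, Finsupp.degree_single]⟩
  by_cases hbig : ∃ j, 2 ≤ (u j).degree
  · obtain ⟨j, hj⟩ := hbig
    obtain ⟨a, v, hv, hdeg⟩ := hsplit j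
    have reduce : ∀ w ≤ u j, w.degree < (u j).degree →
        PrimeChain (variableIdeals σ A (Fintype.card ι))
          (Ideal.span (Set.range fun i => monomial (Function.update u j w i) (1 : A))) ⊤ := by
      intro w hw hlt
      refine ih _ ?_ (Function.update u j w) ?_ rfl
      · rw [← hd]
        refine Finset.sum_lt_sum (fun i _ => ?_) ⟨j, Finset.mem_univ j, by simpa using hlt⟩
        by_cases hi : i = j
        · subst hi
          simpa using hlt.le
        · simp [Function.update_of_ne hi]
      · have hle : ∀ i, Function.update u j w i ≤ u i := by
          intro i
          by_cases hi : i = j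
          · subst hi
            simpa using hw
          · simp [Function.update_of_ne hi]
        exact fun i i' hii' => (hdisj hii').mono (hle i) (hle i')
    have hvle : v ≤ u j := hv ▸ le_add_self
    refine primeChain_of_split hv (fun i hi => (hdisj hi).mono_right hvle) (reduce _ ?_ ?_)
      (reduce v hvle (by omega))
    · exact hv ▸ le_self_add
    · rw [Finsupp.degree_single]
      omega
  · push Not at hbig
    have hone : ∀ i, ∃ a, u i = Finsupp.single a 1 := by
      intro i
      obtain ⟨a, v, hv, hdeg⟩ := hsplit i
      have hlt := hbig i
      have hv0 : v = 0 := (Finsupp.degree_eq_zero_iff v).1 (by omega)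
      exact ⟨a, by rw [hv, hv0, add_zero]⟩
    choose a ha using hone
    have hinj : Function.Injective a := by
      intro i i' h
      by_contra hne
      have hii' : Disjoint (u i) (u i') := hdisj hne
      have huu : u i = u i' := by rw [ha, ha, h]
      rw [huu, disjoint_self] at hii'
      exact hzero i' hii'
    have hspan : Ideal.span (Set.range fun i => monomial (u i) (1 : A)) =
        Ideal.span (X '' (Finset.univ.image a : Finset σ)) := by
      rw [Finset.coe_image, Finset.coe_univ, Set.image_univ, ← Set.range_comp]
      simp only [ha]
      rfl
    refine .step _ _ _ 1 ⟨Finset.univ.image a, Finset.card_image_of_injective _ hinj, hspan⟩ ?_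
      (by simp) ?_
    · rw [hspan]
      exact isPrime_span_X_image _
    · simpa using PrimeChain.refl _

/-- The monomials in a regular sequence are pairwise coprime. -/
theorem pairwise_disjoint_of_isRegular {σ A : Type*} [CommRing A] [Nontrivial A] {k : ℕ}
    {u : Fin k → σ →₀ ℕ}
    (hreg : RingTheory.Sequence.IsRegular (MvPolynomial σ A)
      (List.ofFn fun i => (monomial (u i) (1 : A) : MvPolynomial σ A))) :
    Pairwise fun i j => Disjoint (u i) (u j) := by
  classical
  have hne : ∀ i, u i ≠ 0 := by
    intro i hi
    refine hreg.top_ne_smul (Eq.symm ?_)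
    rw [smul_eq_mul, Ideal.mul_top, Ideal.eq_top_iff_one]
    exact Ideal.subset_span (List.mem_ofFn.2 ⟨i, by simp [hi]⟩)
  have hprev : ∀ (j : Fin k) (w : σ →₀ ℕ), (∃ l < j, u l ≤ w + u j) → ∃ l < j, u l ≤ w := by
    intro j w hw
    have h := hreg.regular_mod_prev j (by simp)
    rw [isSMulRegular_quotient_iff_mem_of_smul_mem] at h
    have hideal : Ideal.ofList ((List.ofFn fun i =>
        (monomial (u i) (1 : A) : MvPolynomial σ A)).take j) =
        Ideal.span (Set.range fun i : {l // l < j} => monomial (u i) (1 : A)) := by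
      refine congrArg Ideal.span (Set.ext fun p => ?_)
      simp only [Set.mem_ofPred_eq, List.mem_take_iff_getElem, List.getElem_ofFn, Set.mem_range,
        Subtype.exists, List.length_ofFn]
      constructor
      · rintro ⟨l, hl, rfl⟩
        exact ⟨⟨l, by omega⟩, Fin.lt_def.2 (by simp; omega), rfl⟩
      · rintro ⟨l, hl, rfl⟩
        exact ⟨l, by omega, rfl⟩
    have h' := h (monomial w 1)
    rw [hideal, smul_eq_mul, smul_eq_mul, Ideal.mul_top, List.getElem_ofFn, mul_comm,
      mul_monomial_mem_span_range_monomial, mem_span_range_monomial] at h'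
    simpa [support_monomial] using h' (by simpa [support_monomial] using hw)
  have hlt : ∀ j i, i < j → Disjoint (u i) (u j) := by
    intro j
    induction j using WellFoundedLT.induction with
    | _ j ih =>
    intro i hij
    rw [disjoint_iff]
    by_contra hinf
    obtain ⟨w, hw⟩ : ∃ w, u i = w + u i ⊓ u j :=
      le_iff_exists_add'.1 inf_le_left
    obtain ⟨l, hlj, hl⟩ := hprev j w ⟨i, hij, by
      conv_lhs => rw [hw]
      gcongr
      exact inf_le_right⟩
    have hwi : w ≤ u i := hw ▸ le_self_add
    rcases lt_trichotomy l i with hli | rfl | hil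
    · exact hne l ((ih i hij l hli).eq_bot_of_le (hl.trans hwi))
    · have : w = u l := le_antisymm hwi hl
      rw [this] at hw
      exact hinf (left_eq_add.1 hw)
    · exact hne l ((ih l hlj i hil).symm.eq_bot_of_le (hl.trans hwi))
  intro i j hij
  rcases lt_or_gt_of_ne hij with h | h
  · exact hlt j i h
  · exact (hlt i j h).symm

end MvPolynomial

theorem isPrettyClean_of_monomial_regular_sequence {K : Type*} [Field K] {n k : ℕ}
    (u : Fin k → (Fin n →₀ ℕ))
    (hreg : RingTheory.Sequence.IsRegular (MvPolynomial (Fin n) K)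
      (List.ofFn fun i => (monomial (u i) (1 : K) : MvPolynomial (Fin n) K))) :
    (Ideal.span (Set.range fun i =>
      (monomial (u i) (1 : K) : MvPolynomial (Fin n) K))).IsPrettyClean := by
  obtain ⟨F, hF⟩ := (primeChain_of_pairwise_disjoint (A := K) u
    (pairwise_disjoint_of_isRegular hreg)).exists_primeFiltration rfl
  refine ⟨F, fun i j _ hle => ?_⟩
  obtain ⟨s, hs, hsi⟩ := hF i
  obtain ⟨t, ht, htj⟩ := hF j
  rw [hsi, htj] at hle ⊢
  rw [eq_of_span_X_image_le (hs.trans ht.symm) hle]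

end
end
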